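/- Let G be a finite group in which every maximal subgroup is normal and G/Frat(G) is not a p-group for any single prime p. Then m(G) > d(G) is possible only if G/Frat(G) has chief factors with at least two distinct primes; more concretely: if G is a finite nilpotent group whose order is divisible by exactly k distinct primes, then m(G) = d(G_{p_1}) + ⋯ + d(G_{p_k}) where G_{p_i} are the Sylow subgroups, while d(G) = max_i d(G_{p_i}). -/

import Mathlib

def IndepGen {G : Type*} [Group G] (S : Set G) : Prop :=
  Subgroup.closure S = ⊤ ∧ ∀ s ∈ S, Subgroup.closure (S \ {s}) < ⊤

noncomputable def mGen (G : Type*) [Group G] : ℕ :=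
  sSup {n | ∃ S : Finset G, IndepGen (S : Set G) ∧ S.card = n}

theorem aux_exists_hom {Q : Type*} [Group Q] [Finite Q] {p : ℕ} (hp : p.Prime)
    (hQ : IsPGroup p Q) (H : Subgroup Q) (hH : H ≠ ⊤) :
    ∃ φ : Q →* Multiplicative (ZMod p), (∀ h ∈ H, φ h = 1) ∧ ∃ x, φ x ≠ 1 := by
  have := Fact.mk hp
  obtain ⟨M, hM, hHM⟩ := (eq_top_or_exists_le_coatom H).resolve_left hH
  have : Group.IsNilpotent Q := hQ.isNilpotent
  have : M.Normal := Subgroup.NormalizerCondition.normal_of_coatom _ Group.normalizerCondition_of_isNilpotent hM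
  have hidx : Nat.card (Q ⧸ M) = p := by
    obtain ⟨n, hn⟩ := (IsPGroup.iff_card.mp (hQ.to_subgroup M))
    obtain ⟨k, hk⟩ := (IsPGroup.iff_card.mp hQ)
    have hlt : n < k := by
      by_contra hle
      have h2 : Nat.card Q ≤ Nat.card M := by
        rw [hn, hk]
        exact Nat.pow_le_pow_right hp.pos (by omega)
      exact hM.1 (Subgroup.eq_top_of_le_card M h2)
    obtain ⟨K, hK, hMK⟩ := Sylow.exists_subgroup_card_pow_succ (p := p) (n := n)
      (by rw [hk]; exact pow_dvd_pow p hlt) hn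
    have hKtop : K = ⊤ := by
      apply hM.2
      refine lt_of_le_of_ne hMK ?_
      rintro rfl
      rw [hn] at hK
      exact absurd (Nat.pow_right_injective hp.two_le hK) (by omega)
    rw [hKtop, Subgroup.card_top] at hK
    have h3 := Subgroup.card_eq_card_quotient_mul_card_subgroup M
    rw [hK, hn, pow_succ, mul_comm] at h3
    exact (Nat.eq_of_mul_eq_mul_right (pow_pos hp.pos n) h3).symm
  let e : Q ⧸ M ≃* Multiplicative (ZMod p) :=
    mulEquivOfPrimeCardEq (p := p) hidx (by simp)
  refine ⟨e.toMonoidHom.comp (QuotientGroup.mk' M), ?_, ?_⟩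
  · intro h hh
    have : (QuotientGroup.mk' M) h = 1 := (QuotientGroup.eq_one_iff h).mpr (hHM hh)
    simp only [MonoidHom.comp_apply, this, map_one]
  · obtain ⟨x, hx⟩ : ∃ x, x ∉ M := by
      by_contra! hcon
      exact hM.1 ((Subgroup.eq_top_iff' M).mpr hcon)
    refine ⟨x, fun h => hx ?_⟩
    have h' : e ((QuotientGroup.mk' M) x) = 1 := h
    rw [e.map_eq_one_iff] at h'
    exact (QuotientGroup.eq_one_iff x).mp h'

theorem aux_zmod_generate {p : ℕ} (hp : p.Prime) (a b : Multiplicative (ZMod p)) (ha : a ≠ 1) :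
    ∃ n : ℤ, a ^ n = b := by
  have := Fact.mk hp
  have := mem_zpowers_of_prime_card (G := Multiplicative (ZMod p)) (p := p) (by simp)
    (g := a) (g' := b) ha
  exact Subgroup.mem_zpowers_iff.mp this

theorem aux_card_le_rank {Q ι : Type*} [Group Q] [Finite Q] {p : ℕ} (hp : p.Prime)
    (hQ : IsPGroup p Q) (f : ι → Q) (S : Set ι) (T : Finset ι) (hTS : ∀ t ∈ T, t ∈ S)
    (hgen : Subgroup.closure (f '' S) = ⊤)
    (hT : ∀ t ∈ T, Subgroup.closure (f '' (S \ {t})) ≠ ⊤) : T.card ≤ Group.rank Q := by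
  classical
  have := Fact.mk hp
  have key : ∀ t : T, ∃ φ : Q →* Multiplicative (ZMod p),
      (∀ s ∈ S, s ≠ t → φ (f s) = 1) ∧ φ (f t) ≠ 1 := by
    rintro ⟨t, ht⟩
    obtain ⟨φ, h1, x, hx⟩ := aux_exists_hom hp hQ _ (hT t ht)
    have h1' : ∀ s ∈ S, s ≠ t → φ (f s) = 1 := fun s hs hst =>
      h1 _ (Subgroup.subset_closure ⟨s, ⟨hs, hst⟩, rfl⟩)
    refine ⟨φ, h1', fun hft => hx ?_⟩
    have : Subgroup.closure (f '' S) ≤ φ.ker := by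
      rw [Subgroup.closure_le]
      rintro _ ⟨s, hs, rfl⟩
      by_cases hst : s = t
      · subst hst; exact hft
      · exact h1' s hs hst
    rw [hgen] at this
    exact this (Subgroup.mem_top x)
  choose φ hφ1 hφ2 using key
  let Φ : Q →* (T → Multiplicative (ZMod p)) := MonoidHom.pi φ
  have hsurj : Function.Surjective Φ := by
    intro y
    rw [← MonoidHom.mem_range]
    apply Subgroup.pi_mem_of_mulSingle_mem
    intro t
    obtain ⟨n, hn⟩ := aux_zmod_generate hp (φ t (f t)) (y t) (hφ2 t)
    refine ⟨f t ^ n, ?_⟩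
    funext u
    by_cases hut : u = t
    · subst hut
      simp [Φ, hn]
    · have : φ u (f t) = 1 := hφ1 u t (hTS t t.2) (fun h => hut (Subtype.ext h.symm))
      simp [Φ, this, Pi.mulSingle_eq_of_ne hut]
  have h1 := Group.rank_le_of_surjective Φ hsurj
  have h2 := card_dvd_exponent_pow_rank' (T → Multiplicative (ZMod p)) (n := p) (by
    intro g
    funext t
    have := pow_card_eq_one' (G := Multiplicative (ZMod p)) (x := g t)
    simpa using this)
  have h3 : Nat.card (T → Multiplicative (ZMod p)) = p ^ T.card := by
    rw [Nat.card_fun]; simp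
  rw [h3] at h2
  exact ((Nat.pow_dvd_pow_iff_le_right hp.one_lt).mp h2).trans h1

theorem aux_proj {G : Type*} [Group G] [Finite G]
    (hnil : Group.IsNilpotent G) (P : (p : ℕ) → Sylow p G) :
    ∃ π : (p : (Nat.card G).primeFactors) → G →* (P p : Subgroup G),
      (∀ p : (Nat.card G).primeFactors, ∀ x : (P p : Subgroup G), π p x = x) ∧
      (∀ p q : (Nat.card G).primeFactors, p ≠ q → ∀ x : (P q : Subgroup G), π p x = 1) ∧
      (∀ y : (p : (Nat.card G).primeFactors) → (P p : Subgroup G), ∃ g, ∀ p, π p g = y p) ∧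
      (⨆ p : (Nat.card G).primeFactors, (P p : Subgroup G) = ⊤) ∧
      (∀ H : Subgroup G, (∀ p, H.map (π p) = ⊤) → H = ⊤) := by
  classical
  have hn : ∀ p : (Nat.card G).primeFactors, (P p : Subgroup G).Normal := by
    rintro ⟨p, hp⟩
    have := Fact.mk (Nat.prime_of_mem_primeFactors hp)
    exact (P p).normal_of_normalizerCondition Group.normalizerCondition_of_isNilpotent
  have hcop : Pairwise fun p₁ p₂ : (Nat.card G).primeFactors =>
      Nat.Coprime (Nat.card (P p₁ : Subgroup G)) (Nat.card (P p₂ : Subgroup G)) := by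
    rintro ⟨p₁, hp₁⟩ ⟨p₂, hp₂⟩ hne
    have hp₁' := Fact.mk (Nat.prime_of_mem_primeFactors hp₁)
    have hp₂' := Fact.mk (Nat.prime_of_mem_primeFactors hp₂)
    have hne' : p₁ ≠ p₂ := by simpa using hne
    apply IsPGroup.coprime_card_of_ne p₁ p₂ hne' _ _ (P p₁).isPGroup' (P p₂).isPGroup'
  have hcomm : Pairwise fun p₁ p₂ : (Nat.card G).primeFactors =>
      ∀ x y : G, x ∈ (P p₁ : Subgroup G) → y ∈ (P p₂ : Subgroup G) → Commute x y := by
    rintro ⟨p₁, hp₁⟩ ⟨p₂, hp₂⟩ hne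
    have hp₁' := Fact.mk (Nat.prime_of_mem_primeFactors hp₁)
    have hp₂' := Fact.mk (Nat.prime_of_mem_primeFactors hp₂)
    have hne' : p₁ ≠ p₂ := by simpa using hne
    apply Subgroup.commute_of_normal_of_disjoint _ _ (hn ⟨p₁, hp₁⟩) (hn ⟨p₂, hp₂⟩)
    apply IsPGroup.disjoint_of_ne p₁ p₂ hne' _ _ (P p₁).isPGroup' (P p₂).isPGroup'
  have hcard : Nat.card (∀ p : (Nat.card G).primeFactors, (P p : Subgroup G)) = Nat.card G := by
    calc
      Nat.card (∀ p : (Nat.card G).primeFactors, (P p : Subgroup G))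
        = ∏ p : (Nat.card G).primeFactors, Nat.card (P p : Subgroup G) := Nat.card_pi
      _ = ∏ p : (Nat.card G).primeFactors, p.1 ^ (Nat.card G).factorization p.1 := by
        congr 1 with ⟨p, hp⟩
        exact @Sylow.card_eq_multiplicity _ _ _ p ⟨Nat.prime_of_mem_primeFactors hp⟩ (P p)
      _ = ∏ p ∈ (Nat.card G).primeFactors, p ^ (Nat.card G).factorization p :=
        Finset.prod_finset_coe (fun p => p ^ (Nat.card G).factorization p) _
      _ = (Nat.card G).factorization.prod (· ^ ·) := rfl
      _ = Nat.card G := Nat.prod_factorization_pow_eq_self Nat.card_pos.ne'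
  have hbij : Function.Bijective (Subgroup.noncommPiCoprod hcomm) := by
    have : ∀ p : (Nat.card G).primeFactors, Fintype (P p : Subgroup G) :=
      fun p => Fintype.ofFinite _
    rw [Nat.bijective_iff_injective_and_card]
    refine ⟨?_, hcard⟩
    apply Subgroup.injective_noncommPiCoprod_of_iSupIndep
    apply Subgroup.independent_of_coprime_order hcomm
    intro p q hpq
    simpa only [← Nat.card_eq_fintype_card] using hcop hpq
  let e := MulEquiv.ofBijective _ hbij
  have he : ∀ q, ∀ x : (P q.1 : Subgroup G), e.symm x = Pi.mulSingle q x := by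
    intro q x
    rw [MulEquiv.symm_apply_eq]
    exact (Subgroup.noncommPiCoprod_mulSingle (hcomm := hcomm) q x).symm
  refine ⟨fun p => (Pi.evalMonoidHom _ p).comp e.symm.toMonoidHom, ?_, ?_, ?_, ?_, ?_⟩
  · intro p x
    change e.symm x p = x
    rw [he p x]; simp
  · intro p q hpq x
    change e.symm x p = 1
    rw [he q x]; exact Pi.mulSingle_eq_of_ne hpq _
  · intro y
    refine ⟨e y, fun p => ?_⟩
    change e.symm (e y) p = y p
    rw [MulEquiv.symm_apply_apply]
  · rw [← Subgroup.noncommPiCoprod_range (hcomm := hcomm), MonoidHom.range_eq_top]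
    exact hbij.2
  · intro H hH
    apply Subgroup.eq_top_of_le_card
    apply Nat.le_of_dvd Nat.card_pos
    rw [← hcard, Nat.card_pi]
    apply Finset.prod_dvd_of_isRelPrime
    · intro p _ q _ hpq
      exact Nat.coprime_iff_isRelPrime.mp (hcop hpq)
    · intro p _
      have := Subgroup.card_map_dvd H ((Pi.evalMonoidHom _ p).comp e.symm.toMonoidHom)
      rw [hH p, Subgroup.card_top] at this
      exact this

theorem nilpotent_m_and_d (G : Type*) [Group G] [Finite G]
    (hnil : Group.IsNilpotent G) (P : (p : ℕ) → Sylow p G) :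
    mGen G = ∑ p ∈ (Nat.card G).primeFactors, Group.rank (P p : Subgroup G) ∧
    Group.rank G = ((Nat.card G).primeFactors).sup
      (fun p => Group.rank (P p : Subgroup G)) := by
  classical
  obtain ⟨π, hπ1, hπ2, hπ3, hsup, htop⟩ := aux_proj hnil P
  have hsurj : ∀ p, Function.Surjective (π p) := fun p x => ⟨x, hπ1 p x⟩
  choose A hAcard hAgen using fun p : (Nat.card G).primeFactors =>
    Group.rank_spec (P p : Subgroup G)
  constructor
  · rw [← Finset.sum_coe_sort]
    apply IsGreatest.csSup_eq
    constructor
    · let B : (p : (Nat.card G).primeFactors) → Finset G :=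
        fun p => (A p).map ⟨Subtype.val, Subtype.val_injective⟩
      have hone : ∀ p, (1 : (P p.1 : Subgroup G)) ∉ A p := by
        intro p h1
        have : Subgroup.closure (((A p).erase 1 : Finset _) : Set (P p.1 : Subgroup G)) = ⊤ := by
          rw [← hAgen p, Finset.coe_erase, Subgroup.closure_sdiff_one]
        have := Group.rank_le this
        have h3 := Finset.card_erase_lt_of_mem h1
        rw [hAcard] at h3
        omega
      have hBmem : ∀ p x, x ∈ B p ↔ ∃ h : x ∈ (P p.1 : Subgroup G), ⟨x, h⟩ ∈ A p := by
        intro p x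
        simp [B]
      have hdisj : ∀ p q, p ≠ q → Disjoint (B p) (B q) := by
        intro p q hpq
        rw [Finset.disjoint_left]
        intro x hx hx'
        obtain ⟨h, hA⟩ := (hBmem p x).mp hx
        obtain ⟨h', hA'⟩ := (hBmem q x).mp hx'
        have e1 := hπ1 p ⟨x, h⟩
        have e2 := hπ2 p q hpq ⟨x, h'⟩
        apply hone p
        rw [← e2]
        change π p x ∈ A p
        change π p x = ⟨x, h⟩ at e1
        rwa [e1]
      refine ⟨Finset.univ.biUnion B, ⟨?_, ?_⟩, ?_⟩
      · rw [eq_top_iff, ← hsup, iSup_le_iff]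
        intro p
        have : (P p.1 : Subgroup G) = Subgroup.closure (B p : Set G) := by
          have h := congrArg (Subgroup.map (P p.1 : Subgroup G).subtype) (hAgen p)
          rw [MonoidHom.map_closure, ← MonoidHom.range_eq_map, Subgroup.range_subtype] at h
          rw [← h]
          congr 1
          simp [B]
        rw [this]
        apply Subgroup.closure_mono
        intro x hx
        simp only [Finset.coe_biUnion, Set.mem_iUnion]
        exact ⟨p, by simp, hx⟩
      · intro s hs
        rw [lt_top_iff_ne_top]
        intro hcl
        simp only [Finset.coe_biUnion, Set.mem_iUnion, Finset.mem_coe] at hs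
        obtain ⟨p, -, hsB⟩ := hs
        obtain ⟨h, hA⟩ := (hBmem p s).mp hsB
        have hm := congrArg (Subgroup.map (π p)) hcl
        rw [MonoidHom.map_closure, ← MonoidHom.range_eq_map,
          MonoidHom.range_eq_top.mpr (hsurj p)] at hm
        have h2 : Subgroup.closure
            (((A p).erase ⟨s, h⟩ : Finset _) : Set (P p.1 : Subgroup G)) = ⊤ := by
          rw [eq_top_iff, ← hm, Subgroup.closure_le]
          rintro _ ⟨x, ⟨hx, hxs⟩, rfl⟩
          simp only [Finset.coe_biUnion, Set.mem_iUnion, Finset.mem_coe] at hx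
          obtain ⟨q, -, hxB⟩ := hx
          obtain ⟨h', hA'⟩ := (hBmem q x).mp hxB
          by_cases hpq : p = q
          · subst hpq
            have e1 : π p x = ⟨x, h'⟩ := hπ1 p ⟨x, h'⟩
            rw [e1]
            apply Subgroup.subset_closure
            rw [Finset.mem_coe, Finset.mem_erase]
            exact ⟨fun hh => hxs (congrArg Subtype.val hh), hA'⟩
          · have e1 : π p x = 1 := hπ2 p q hpq ⟨x, h'⟩
            rw [e1]
            exact Subgroup.one_mem _
        have := Group.rank_le h2
        have h3 := Finset.card_erase_lt_of_mem hA
        rw [hAcard] at h3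
        omega
      · rw [Finset.card_biUnion (fun p _ q _ hpq => hdisj p q hpq)]
        apply Finset.sum_congr rfl
        intro p _
        rw [← hAcard p]
        simp [B]
    · rintro n ⟨S, ⟨hS1, hS2⟩, rfl⟩
      have hex' : ∀ s ∈ S, ∃ p, (Subgroup.closure ((S : Set G) \ {s})).map (π p) ≠ ⊤ := by
        intro s hs
        by_contra! hcon
        exact (hS2 s hs).ne (htop _ hcon)
      rcases S.eq_empty_or_nonempty with hSe | ⟨s0, hs0⟩
      · simp [hSe]
      obtain ⟨p0, -⟩ := hex' s0 hs0
      have hex : ∀ s : G, ∃ p, s ∈ S → (Subgroup.closure ((S : Set G) \ {s})).map (π p) ≠ ⊤ := by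
        intro s
        by_cases hs : s ∈ S
        · obtain ⟨p, hp⟩ := hex' s hs
          exact ⟨p, fun _ => hp⟩
        · exact ⟨p0, fun h => absurd h hs⟩
      choose c hc using hex
      rw [Finset.card_eq_sum_card_fiberwise (f := c) (t := Finset.univ) (by simp)]
      apply Finset.sum_le_sum
      intro p _
      apply aux_card_le_rank (Nat.prime_of_mem_primeFactors p.2) (P p.1).isPGroup' (π p) (S : Set G)
      · intro t ht
        exact (Finset.mem_filter.mp ht).1
      · rw [← MonoidHom.map_closure, hS1, ← MonoidHom.range_eq_map,
          MonoidHom.range_eq_top.mpr (hsurj p)]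
      · intro t ht
        obtain ⟨h1, h2⟩ := Finset.mem_filter.mp ht
        rw [← MonoidHom.map_closure, ← h2]
        exact hc t h1
  · apply le_antisymm
    · set d := ((Nat.card G).primeFactors).sup
        (fun p => Group.rank (P p : Subgroup G)) with hd
      have hx : ∀ p : (Nat.card G).primeFactors, ∃ x : Fin d → (P p.1 : Subgroup G),
          Subgroup.closure (Set.range x) = ⊤ := by
        intro p
        have hle : (A p).card ≤ d := by
          rw [hAcard]
          exact Finset.le_sup (f := fun p => Group.rank (P p : Subgroup G)) p.2
        let e := (A p).equivFin
        refine ⟨fun i => if h : i.1 < (A p).card then (e.symm ⟨i.1, h⟩ : _) else 1, ?_⟩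
        rw [eq_top_iff, ← hAgen p]
        apply Subgroup.closure_mono
        intro a ha
        refine ⟨⟨(e ⟨a, ha⟩).1, (e ⟨a, ha⟩).2.trans_le hle⟩, ?_⟩
        simp
      choose x hx using hx
      choose g hg using fun i : Fin d => hπ3 (fun p => x p i)
      have hgen : Subgroup.closure ((Finset.univ.image g : Finset G) : Set G) = ⊤ := by
        apply htop
        intro p
        rw [MonoidHom.map_closure, ← hx p]
        congr 1
        ext y
        simp [hg]
      refine (Group.rank_le hgen).trans ?_
      exact Finset.card_image_le.trans (by simp)
    · apply Finset.sup_le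
      intro p hp
      exact Group.rank_le_of_surjective (π ⟨p, hp⟩) (hsurj ⟨p, hp⟩)
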